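/- The elimination operators represent n_T: for all rooted trees T1, T2, the commutator of elimination operators satisfies E_{T1} ∘ E_{T2} − E_{T2} ∘ E_{T1} = −Σ_T (a(T1,T2;T) − a(T2,T1;T))·E_T (sum over isomorphism classes of rooted trees T). Equivalently, the linear map n_T → End(H*) sending T ↦ −E_T is a homomorphism of Lie algebras, so the elimination action X_T·φ := −E_T φ makes H* a representation of n_T. -/

import Mathlib

open scoped Classical

/-- Concrete (labeled) rooted trees: a root with a list of subtrees. -/
inductive RTree : Type
  | node : List RTree → RTree

/-- Shapes of admissible cuts: at each tree, either the full cut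
(everything, including the root, goes to the pruned part `P`), or a choice of
an admissible cut of each child subtree.  A `full` occurring strictly inside
corresponds to cutting the edge above that vertex. -/
inductive CutShape : Type
  | full
  | branch : List CutShape → CutShape

namespace CK

/-- Number of vertices of a forest. -/
def sizeL : List RTree → ℕ
  | [] => 0
  | .node l :: ts => 1 + sizeL l + sizeL ts

/-- All admissible cuts of a forest (a choice of admissible cut of each tree). -/
def cutsF : List RTree → List (List CutShape)
  | [] => [[]]
  | .node l :: ts =>
      (CutShape.full :: (cutsF l).map CutShape.branch).flatMap
        fun c => (cutsF ts).map (c :: ·)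

/-- The root part `R_C(F)` of a cut. -/
def Rcut : List RTree → List CutShape → List RTree
  | [], _ => []
  | _ :: _, [] => []
  | .node _ :: ts, .full :: cs => Rcut ts cs
  | .node l :: ts, .branch ds :: cs => RTree.node (Rcut l ds) :: Rcut ts cs

/-- The pruned part `P_C(F)` of a cut. -/
def Pcut : List RTree → List CutShape → List RTree
  | [], _ => []
  | _ :: _, [] => []
  | .node l :: ts, .full :: cs => RTree.node l :: Pcut ts cs
  | .node l :: ts, .branch ds :: cs => Pcut l ds ++ Pcut ts cs

/-- Number of `full`s occurring in a cut. -/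
def fullsL : List CutShape → ℕ
  | [] => 0
  | .full :: cs => 1 + fullsL cs
  | .branch ds :: cs => fullsL ds + fullsL cs

/-- A list of concrete forests containing (representatives of) every forest
with at most `n` vertices. -/
def forestsUpTo : ℕ → List (List RTree)
  | 0 => [[]]
  | n+1 => [] :: (forestsUpTo n).flatMap fun l => (forestsUpTo n).map fun F => RTree.node l :: F

/-- Isomorphism of rooted trees (non-planar): a root-preserving bijection, i.e.
the lists of subtrees agree up to permutation and isomorphism. -/
inductive Iso : RTree → RTree → Prop
  | node {l₁ l l₂ : List RTree} : List.Forall₂ Iso l₁ l → l.Perm l₂ → Iso (.node l₁) (.node l₂)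

/-- Isomorphism classes of rooted trees. -/
abbrev TreeClass : Type := Quot Iso

/-- Isomorphism classes of rooted forests = multisets of tree classes.
The empty forest is `0`. -/
abbrev ForestClass : Type := Multiset TreeClass

/-- Isomorphism class of a tree. -/
def clT (t : RTree) : TreeClass := Quot.mk _ t

/-- Isomorphism class of a forest. -/
def clF (F : List RTree) : ForestClass := (F.map clT : List TreeClass)

/-- A concrete representative of a forest class. -/
noncomputable def repF (M : ForestClass) : List RTree := M.toList.map Quot.out

/-- A concrete representative of a tree class. -/
noncomputable def repT (T : TreeClass) : RTree := T.out

/-- Number of vertices of a forest class. -/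
noncomputable def sizeC (M : ForestClass) : ℕ := sizeL (repF M)

/-- Number of vertices of a tree class. -/
noncomputable def sizeT (T : TreeClass) : ℕ := sizeL [repT T]

/-- The Hall algebra `H`: finitely supported ℚ-valued functions on
isomorphism classes of rooted forests, with basis the delta functions. -/
abbrev H : Type := ForestClass →₀ ℚ

/-- The basis element `δ_A` of `H`. -/
noncomputable def delta (A : ForestClass) : H := Finsupp.single A 1

/-- `n(A,B;M)`: the number of admissible cuts `C` of `M` with
`P_C(M) ≅ A` and `R_C(M) ≅ B`. -/
noncomputable def nCuts (A B M : ForestClass) : ℕ :=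
  (cutsF (repF M)).countP fun c =>
    decide (clF (Pcut (repF M) c) = A ∧ clF (Rcut (repF M) c) = B)

/-- A finite set of forest classes containing all classes with at most `n`
vertices. -/
noncomputable def forestCand (n : ℕ) : Finset ForestClass :=
  ((forestsUpTo n).map clF).toFinset

/-- A finite set of tree classes containing all classes with at most `n+1`
vertices. -/
noncomputable def treeCand (n : ℕ) : Finset TreeClass :=
  ((forestsUpTo n).map fun F => clT (RTree.node F)).toFinset

/-- The Hall product on basis elements: `δ_A × δ_B = Σ_M n(A,B;M)·δ_M`
(every `M` with `n(A,B;M) ≠ 0` has exactly `sizeC A + sizeC B` vertices). -/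
noncomputable def mulBasis (A B : ForestClass) : H :=
  ∑ M ∈ forestCand (sizeC A + sizeC B), (nCuts A B M : ℚ) • delta M

/-- The Hall product on `H`, extended bilinearly from basis elements. -/
noncomputable def hmul (f g : H) : H :=
  f.sum fun A a => g.sum fun B b => (a * b) • mulBasis A B

/-- The Connes-Kreimer Lie algebra `n_T` (as a vector space): the span of
isomorphism classes of rooted trees. -/
abbrev nT : Type := TreeClass →₀ ℚ

/-- The basis element of `n_T` corresponding to a rooted tree `T`. -/
noncomputable def tau (T : TreeClass) : nT := Finsupp.single T 1

/-- `a(T₁,T₂;T)`: the number of edges `e` of `T` such that the single-edge cut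
at `e` has pruned part `≅ T₁` and root part `≅ T₂`. -/
noncomputable def aCount (T₁ T₂ T : TreeClass) : ℕ :=
  (cutsF [repT T]).countP fun c =>
    decide (fullsL c = 1 ∧ clF (Pcut [repT T] c) = ({T₁} : Multiset TreeClass)
      ∧ clF (Rcut [repT T] c) = ({T₂} : Multiset TreeClass))

/-- The grafting (pre-Lie) product on basis elements:
`T₁ * T₂ = Σ_T a(T₁,T₂;T)·T`. -/
noncomputable def graftBasis (T₁ T₂ : TreeClass) : nT :=
  ∑ T ∈ treeCand (sizeT T₁ + sizeT T₂), (aCount T₁ T₂ T : ℚ) • tau T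

/-- The grafting (pre-Lie) product on `n_T`, extended bilinearly. -/
noncomputable def graft (x y : nT) : nT :=
  x.sum fun T₁ a => y.sum fun T₂ b => (a * b) • graftBasis T₁ T₂

/-- The Connes-Kreimer bracket `[x,y] = x*y - y*x` on `n_T`. -/
noncomputable def ckBracket (x y : nT) : nT := graft x y - graft y x

/-- `Ẽ_A δ_B = Σ_C δ_{R_C(B)}`, the sum over admissible cuts `C` of `B` with
`P_C(B) ≅ A`. -/
noncomputable def elimBasis (A B : ForestClass) : H :=
  (((cutsF (repF B)).filter fun c => decide (clF (Pcut (repF B) c) = A)).map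
    fun c => delta (clF (Rcut (repF B) c))).sum

/-- The elimination operator `E_A` (here on `H ≅ H*`, identifying `φ_B` with
`δ_B`). -/
noncomputable def elim (A : ForestClass) : H →ₗ[ℚ] H :=
  Finsupp.lsum ℚ fun B => LinearMap.toSpanSingleton ℚ H (elimBasis A B)

/-- `Ẽ^top_A δ_B = Σ_C δ_{P_C(B)}`, the sum over admissible cuts `C` of `B`
with `R_C(B) ≅ A`. -/
noncomputable def topElimBasis (A B : ForestClass) : H :=
  (((cutsF (repF B)).filter fun c => decide (clF (Rcut (repF B) c) = A)).map
    fun c => delta (clF (Pcut (repF B) c))).sum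

/-- The top-elimination operator `E^top_A`. -/
noncomputable def topElim (A : ForestClass) : H →ₗ[ℚ] H :=
  Finsupp.lsum ℚ fun B => LinearMap.toSpanSingleton ℚ H (topElimBasis A B)

/-- `H ⊗ H`, realized as finitely supported functions on pairs of classes. -/
abbrev H2 : Type := (ForestClass × ForestClass) →₀ ℚ

/-- `Δ(δ_M) = Σ δ_A ⊗ δ_B`, the sum over ordered pairs `(A,B)` of classes with
`A ⊔ B ≅ M`. -/
noncomputable def deltaBasis (M : ForestClass) : H2 :=
  ∑ A ∈ M.powerset.toFinset, Finsupp.single (A, M - A) 1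

/-- The coproduct `Δ : H → H ⊗ H`. -/
noncomputable def coprod : H →ₗ[ℚ] H2 :=
  Finsupp.lsum ℚ fun M => LinearMap.toSpanSingleton ℚ H2 (deltaBasis M)

/-- The linear map `n_T → End(H*)` sending a rooted tree `T` to `−E_T`. -/
noncomputable def rho : nT →ₗ[ℚ] (H →ₗ[ℚ] H) :=
  Finsupp.lsum ℚ fun T =>
    LinearMap.toSpanSingleton ℚ (H →ₗ[ℚ] H) (- elim ({T} : Multiset TreeClass))

/-! ### Isomorphism classes -/

theorem forest_induction {p : List RTree → Prop} (h0 : p [])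
    (h1 : ∀ l ts, p l → p ts → p (.node l :: ts)) : ∀ F, p F
  | [] => h0
  | .node l :: ts => h1 l ts (forest_induction h0 h1 l) (forest_induction h0 h1 ts)

theorem forall₂_iso_refl : ∀ F : List RTree, List.Forall₂ Iso F F := by
  apply forest_induction
  · exact .nil
  · intro l ts hl hts
    exact .cons (.node hl (List.Perm.refl _)) hts

theorem clT_node_perm {l l' : List RTree} (h : l.Perm l') :
    clT (.node l) = clT (.node l') :=
  Quot.sound (.node (forall₂_iso_refl l) h)

theorem clT_node_replace (pre l : List RTree) (t t' : RTree) (h : clT t = clT t') :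
    clT (.node (pre ++ t :: l)) = clT (.node (pre ++ t' :: l)) := by
  have key : ∀ a b : RTree, Iso a b →
      clT (.node (pre ++ a :: l)) = clT (.node (pre ++ b :: l)) := by
    intro a b hab
    apply Quot.sound
    refine .node (l := pre ++ b :: l) ?_ (List.Perm.refl _)
    exact List.rel_append (forall₂_iso_refl pre) (.cons hab (forall₂_iso_refl l))
  exact congrArg (Quot.lift (fun a => clT (.node (pre ++ a :: l))) key) h

theorem clT_out (T : TreeClass) : clT (Quot.out T) = T := Quot.out_eq T

theorem clT_node_out (l : List RTree) : ∀ pre : List RTree,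
    clT (.node (pre ++ l)) = clT (.node (pre ++ (l.map clT).map Quot.out)) := by
  induction l with
  | nil => intro pre; rfl
  | cons t l ih =>
    intro pre
    have h1 := clT_node_replace pre l t (Quot.out (clT t)) (clT_out _).symm
    have h2 := ih (pre ++ [Quot.out (clT t)])
    rw [h1]
    simpa using h2

/-- The class of the tree whose root has the given forest of branches. -/
noncomputable def NC (M : ForestClass) : TreeClass := clT (.node (repF M))

theorem NC_clF (l : List RTree) : NC (clF l) = clT (.node l) := by
  have h := clT_node_out l []
  simp only [List.nil_append] at h
  rw [h]
  apply clT_node_perm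
  apply List.Perm.map
  rw [← Multiset.coe_eq_coe, Multiset.coe_toList]
  rfl

theorem clF_repF (M : ForestClass) : clF (repF M) = M := by
  have : (M.toList.map Quot.out).map clT = M.toList := by
    rw [List.map_map]
    conv_rhs => rw [← List.map_id M.toList]
    apply List.map_congr_left
    intro a _
    exact clT_out a
  simp only [clF, repF]
  rw [this, Multiset.coe_toList]

@[simp] theorem clF_nil : clF [] = 0 := rfl

theorem clF_cons (l ts : List RTree) : clF (.node l :: ts) = {NC (clF l)} + clF ts := by
  rw [NC_clF]; rfl

theorem clF_append (F G : List RTree) : clF (F ++ G) = clF F + clF G := by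
  simp [clF]

theorem NC_surj (T : TreeClass) : ∃ l, repT T = .node l ∧ NC (clF l) = T := by
  rcases h : repT T with ⟨l⟩
  refine ⟨l, rfl, ?_⟩
  rw [NC_clF, ← h]
  exact clT_out T

/-! ### Linear structure on `H` -/

/-- Multiplication (disjoint union) by a forest. -/
noncomputable def U (A : ForestClass) : H →ₗ[ℚ] H := Finsupp.lmapDomain ℚ ℚ (A + ·)

/-- Grafting on a new root, as a linear map. -/
noncomputable def NN : H →ₗ[ℚ] H :=
  Finsupp.lmapDomain ℚ ℚ (fun A => ({NC A} : Multiset TreeClass))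

/-- The bilinear disjoint union product. -/
noncomputable def mm : H →ₗ[ℚ] H →ₗ[ℚ] H :=
  Finsupp.lsum ℚ fun A => LinearMap.toSpanSingleton ℚ (H →ₗ[ℚ] H) (U A)

@[simp] theorem U_delta (A B : ForestClass) : U A (delta B) = delta (A + B) := by
  simp [U, delta]

@[simp] theorem NN_delta (A : ForestClass) : NN (delta A) = delta {NC A} := by
  simp [NN, delta]

@[simp] theorem mm_delta (A : ForestClass) : mm (delta A) = U A := by
  simp [mm, delta]

theorem lin_ext {V : Type*} [AddCommMonoid V] [Module ℚ V] {f g : H →ₗ[ℚ] V}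
    (h : ∀ A, f (delta A) = g (delta A)) : f = g := by
  apply Finsupp.lhom_ext'
  intro A
  apply LinearMap.ext_ring
  exact h A

theorem mm_delta_right (y : H) (B : ForestClass) : mm y (delta B) = U B y := by
  have : mm.flip (delta B) = U B := by
    apply lin_ext
    intro A
    simp [add_comm]
  exact LinearMap.congr_fun this y

theorem U_U (A B : ForestClass) (y : H) : U A (U B y) = U (A + B) y := by
  have : U A ∘ₗ U B = U (A + B) := by
    apply lin_ext
    intro C
    simp [add_assoc]
  exact LinearMap.congr_fun this y

theorem U_zero (y : H) : U 0 y = y := by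
  have : U 0 = LinearMap.id := by
    apply lin_ext
    intro C
    simp
  exact LinearMap.congr_fun this y

/-- Operators behaving like the elimination derivations. -/
structure Good (X : H →ₗ[ℚ] H) (c : ForestClass → ℚ) : Prop where
  zero : X (delta 0) = 0
  cons : ∀ l F, X (delta ({NC l} + F)) =
    c l • delta F + U F (NN (X (delta l))) + U {NC l} (X (delta F))

theorem Good.eq_zero {X : H →ₗ[ℚ] H} {c : ForestClass → ℚ} (h : Good X c) (hc : ∀ l, c l = 0) :
    X = 0 := by
  apply lin_ext
  intro A
  rw [← clF_repF A]
  generalize repF A = F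
  revert F
  apply forest_induction
  · simpa using h.zero
  · intro l ts hl hts
    rw [clF_cons, h.cons, hl, hts, hc]
    simp

theorem Good.add {X Y : H →ₗ[ℚ] H} {c d : ForestClass → ℚ} (hX : Good X c) (hY : Good Y d) :
    Good (X + Y) (c + d) := by
  refine ⟨by simp [hX.zero, hY.zero], fun l F => ?_⟩
  simp only [LinearMap.add_apply, hX.cons, hY.cons, map_add, Pi.add_apply, add_smul]
  abel

theorem Good.smul {X : H →ₗ[ℚ] H} {c : ForestClass → ℚ} (a : ℚ) (hX : Good X c) :
    Good (a • X) (a • c) := by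
  refine ⟨by simp [hX.zero], fun l F => ?_⟩
  simp only [LinearMap.smul_apply, hX.cons, map_smul, Pi.smul_apply, smul_add, smul_assoc]

theorem Good.zero_op : Good 0 0 := ⟨by simp, fun l F => by simp⟩

theorem Good.sum {ι : Type*} (s : Finset ι) (a : ι → ℚ) (X : ι → H →ₗ[ℚ] H)
    (c : ι → ForestClass → ℚ) (h : ∀ i, Good (X i) (c i)) :
    Good (∑ i ∈ s, a i • X i) (∑ i ∈ s, a i • c i) := by
  induction s using Finset.induction_on with
  | empty => simpa using Good.zero_op
  | insert i s hi ih =>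
    rw [Finset.sum_insert hi, Finset.sum_insert hi]
    exact ((h i).smul _).add ih

theorem Good.graft_apply {X : H →ₗ[ℚ] H} {c : ForestClass → ℚ} (h : Good X c)
    (F : ForestClass) (y : H) (cc : H →ₗ[ℚ] ℚ) (hcc : ∀ l, cc (delta l) = c l) :
    X (U F (NN y)) = cc y • delta F + U F (NN (X y)) + mm (NN y) (X (delta F)) := by
  have : X ∘ₗ U F ∘ₗ NN = cc.smulRight (delta F) + U F ∘ₗ NN ∘ₗ X
      + mm.flip (X (delta F)) ∘ₗ NN := by
    apply lin_ext
    intro l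
    have := h.cons l F
    rw [Multiset.singleton_add] at this
    simp [add_comm F, this, hcc]
  exact LinearMap.congr_fun this y

theorem Good.U_apply {X : H →ₗ[ℚ] H} {c : ForestClass → ℚ} (h : Good X c)
    (l : ForestClass) (z : H) :
    X (U {NC l} z) = c l • z + mm (NN (X (delta l))) z + U {NC l} (X z) := by
  have : X ∘ₗ U {NC l} = c l • LinearMap.id + mm (NN (X (delta l))) + U {NC l} ∘ₗ X := by
    apply lin_ext
    intro F
    have := h.cons l F
    rw [Multiset.singleton_add] at this
    simp [this, mm_delta_right]
  exact LinearMap.congr_fun this z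

theorem Good.comm {X Y : H →ₗ[ℚ] H} {c d : H →ₗ[ℚ] ℚ} (hX : Good X fun l => c (delta l))
    (hY : Good Y fun l => d (delta l)) :
    Good (X ∘ₗ Y - Y ∘ₗ X) fun l => c (Y (delta l)) - d (X (delta l)) := by
  refine ⟨by simp [hX.zero, hY.zero], fun l F => ?_⟩
  simp only [LinearMap.sub_apply, LinearMap.comp_apply, hX.cons, hY.cons, map_add, map_smul,
    hX.U_apply, hY.U_apply, hX.graft_apply F _ c (fun _ => rfl),
    hY.graft_apply F _ d (fun _ => rfl), map_sub, sub_smul]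
  abel

/-! ### The elimination operators on concrete forests -/

/-- Sum of the root parts over cuts with prescribed pruned part. -/
noncomputable def gs (A : ForestClass) (F : List RTree) : H :=
  ((cutsF F).map fun c => if clF (Pcut F c) = A then delta (clF (Rcut F c)) else 0).sum

theorem sum_filter_map {α V : Type*} [AddCommMonoid V] (p : α → Prop) [DecidablePred p] (f : α → V) (L : List α) :
    ((L.filter fun c => decide (p c)).map f).sum = (L.map fun c => if p c then f c else 0).sum := by
  induction L with
  | nil => rfl
  | cons a L ih =>
    by_cases h : p a
    · simp [h, ih]
    · simp [h, ih]

theorem elim_delta (A B : ForestClass) : elim A (delta B) = gs A (repF B) := by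
  have : elim A (delta B) = elimBasis A B := by simp [elim, delta]
  rw [this, elimBasis, gs]
  exact sum_filter_map (fun c => clF (Pcut (repF B) c) = A) _ _

theorem sum_flatMap_map {α β V : Type*} [AddCommMonoid V] (L : List α) (k : α → List β) (f : β → V) :
    ((L.flatMap k).map f).sum = (L.map fun a => ((k a).map f).sum).sum := by
  induction L with
  | nil => rfl
  | cons a L ih => simp [ih]

theorem gs_cons (A : ForestClass) (l ts : List RTree) : gs A (.node l :: ts) =
    ((cutsF ts).map fun c => if {NC (clF l)} + clF (Pcut ts c) = A
        then delta (clF (Rcut ts c)) else 0).sum +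
    ((cutsF l).map fun d => ((cutsF ts).map fun c => if clF (Pcut l d) + clF (Pcut ts c) = A
        then delta ({NC (clF (Rcut l d))} + clF (Rcut ts c)) else 0).sum).sum := by
  rw [gs, cutsF, sum_flatMap_map]
  simp only [List.map_cons, List.sum_cons, List.map_map, Function.comp_def, Pcut, Rcut, clF_cons,
    clF_append]

theorem linear_list_sum {α V W : Type*} [AddCommMonoid V] [Module ℚ V] [AddCommMonoid W]
    [Module ℚ W] (f : V →ₗ[ℚ] W) (L : List α) (k : α → V) :
    f (L.map k).sum = (L.map fun a => f (k a)).sum := by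
  rw [map_list_sum, List.map_map]; rfl

theorem double_sum (A B : ForestClass) (l ts : List RTree) :
    ((cutsF l).map fun d => ((cutsF ts).map fun c =>
      if clF (Pcut l d) = A ∧ clF (Pcut ts c) = B
        then delta ({NC (clF (Rcut l d))} + clF (Rcut ts c)) else 0).sum).sum
    = mm (NN (gs A l)) (gs B ts) := by
  have h1 : mm (NN (gs A l)) (gs B ts) = (mm.flip (gs B ts) ∘ₗ NN) (gs A l) := rfl
  rw [h1]
  conv_rhs => rw [gs.eq_1 A l]
  rw [linear_list_sum]
  congr 1
  apply List.map_congr_left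
  intro d _
  by_cases hd : clF (Pcut l d) = A
  · simp only [hd, true_and, if_true, LinearMap.comp_apply, NN_delta, LinearMap.flip_apply,
      mm_delta]
    rw [gs, linear_list_sum]
    congr 1
    apply List.map_congr_left
    intro c _
    split_ifs <;> simp
  · simp [hd]

theorem gs_zero (F : List RTree) : gs 0 F = delta (clF F) := by
  revert F
  apply forest_induction
  · simp [gs, cutsF, Pcut, Rcut]
  · intro l ts hl hts
    have := double_sum 0 0 l ts
    rw [gs_cons]
    simp only [add_eq_zero]
    rw [this, hl, hts]
    simp [clF_cons]

theorem add_eq_singleton_iff' {α : Type*} (A B : Multiset α) (t : α) :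
    A + B = {t} ↔ (A = {t} ∧ B = 0) ∨ (A = 0 ∧ B = {t}) := by
  constructor
  · intro h
    have hc := congrArg Multiset.card h
    simp at hc
    rcases Nat.eq_zero_or_pos (Multiset.card A) with h0 | h0
    · rw [Multiset.card_eq_zero] at h0
      subst h0
      right; simpa using h
    · have : Multiset.card B = 0 := by omega
      rw [Multiset.card_eq_zero] at this
      subst this
      left; simpa using h
  · rintro (⟨rfl, rfl⟩ | ⟨rfl, rfl⟩) <;> simp

theorem gs_tree (T : TreeClass) (l ts : List RTree) : gs {T} (.node l :: ts) =
    (if NC (clF l) = T then (1 : ℚ) else 0) • delta (clF ts) + U (clF ts) (NN (gs {T} l))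
      + U {NC (clF l)} (gs {T} ts) := by
  rw [gs_cons, add_assoc]
  congr 1
  · rw [← gs_zero, gs]
    by_cases h : NC (clF l) = T
    · rw [if_pos h, one_smul]
      congr 1
      apply List.map_congr_left
      intro c _
      apply if_congr _ rfl rfl
      rw [add_eq_singleton_iff']
      simp [h]
    · rw [if_neg h, zero_smul]
      apply List.sum_eq_zero
      intro x hx
      obtain ⟨c, -, rfl⟩ := List.mem_map.mp hx
      apply if_neg
      rw [add_eq_singleton_iff']
      simp [h]
  · have h1 := double_sum {T} 0 l ts
    have h2 := double_sum 0 {T} l ts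
    rw [gs_zero, mm_delta_right] at h1
    rw [gs_zero, NN_delta, mm_delta] at h2
    rw [← h1, ← h2, ← List.sum_map_add]
    congr 1
    apply List.map_congr_left
    intro d _
    rw [← List.sum_map_add]
    congr 1
    apply List.map_congr_left
    intro c _
    have hiff := add_eq_singleton_iff' (clF (Pcut l d)) (clF (Pcut ts c)) T
    rw [if_congr hiff rfl rfl]
    by_cases ha : clF (Pcut l d) = {T}
    · simp [ha]
    · simp [ha]

theorem gs_nil (T : TreeClass) : gs {T} [] = 0 := by
  simp [gs, cutsF, Pcut]

/-- General invariance principle. -/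
theorem invariant_of {β : Type*} (f : List RTree → β)
    (hcongr : ∀ t t' F, clT t = clT t' → f [t] = f [t'] → f (t :: F) = f (t' :: F))
    (hcongr' : ∀ t F F', clF F = clF F' → f F = f F' → f (t :: F) = f (t :: F'))
    (hswap : ∀ a b F, f (a :: b :: F) = f (b :: a :: F))
    (hnode : ∀ l l', clF l = clF l' → f l = f l' → f [.node l] = f [.node l']) :
    ∀ F G, clF F = clF G → f F = f G := by
  have clperm : ∀ F G : List RTree, F.Perm G → clF F = clF G := fun F G h =>
    Multiset.coe_eq_coe.mpr (h.map _)
  have hperm : ∀ F G : List RTree, F.Perm G → f F = f G := by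
    intro F G h
    induction h with
    | nil => rfl
    | cons a hp ih => exact hcongr' _ _ _ (clperm _ _ hp) ih
    | swap a b L => exact hswap _ _ _
    | trans _ _ ih1 ih2 => exact ih1.trans ih2
  have hiso : ∀ F G : List RTree, List.Forall₂ Iso F G → clF F = clF G ∧ f F = f G := by
    apply forest_induction
    · intro G hG
      cases hG
      exact ⟨rfl, rfl⟩
    · intro l ts hl hts G hG
      cases hG with
      | cons h1 h2 =>
        rename_i b ts'
        obtain ⟨e1, e2⟩ := hts _ h2
        have hc : clT (.node l) = clT b := Quot.sound h1
        refine ⟨?_, ?_⟩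
        · have : clT (.node l) ::ₘ clF ts = clT b ::ₘ clF ts' := by rw [hc, e1]
          exact this
        · rw [hcongr' _ _ _ e1 e2]
          apply hcongr _ _ _ hc
          cases h1 with
          | node ha hb =>
            obtain ⟨e3, e4⟩ := hl _ ha
            exact hnode _ _ (e3.trans (clperm _ _ hb)) (e4.trans (hperm _ _ hb))
  have htree : ∀ t t', clT t = clT t' → f [t] = f [t'] := fun t t' h =>
    congrArg (Quot.lift (fun a => f [a])
      (fun a b hab => (hiso [a] [b] (.cons hab .nil)).2)) h
  have hmap : ∀ F G : List RTree, F.map clT = G.map clT → f F = f G := by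
    intro F
    induction F with
    | nil => intro G h; cases G with
      | nil => rfl
      | cons => simp at h
    | cons t F ih => intro G h; cases G with
      | nil => simp at h
      | cons t' G =>
        simp only [List.map_cons, List.cons.injEq] at h
        rw [hcongr _ _ _ h.1 (htree _ _ h.1)]
        exact hcongr' _ _ _ (congrArg (fun L : List TreeClass => (L : Multiset TreeClass)) h.2) (ih _ h.2)
  have hout : ∀ F, f F = f ((F.map clT).map Quot.out) := by
    intro F
    apply hmap
    rw [List.map_map, List.map_map]
    apply List.map_congr_left
    intro a _
    exact (clT_out _).symm
  intro F G h
  rw [hout F, hout G]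
  exact hperm _ _ ((Multiset.coe_eq_coe.mp h).map _)

theorem gs_single (T : TreeClass) (t : RTree) (ts : List RTree) :
    gs {T} (t :: ts) = U (clF ts) (gs {T} [t]) + U {clT t} (gs {T} ts) := by
  rcases t with ⟨l⟩
  rw [gs_tree, gs_tree, gs_nil, NC_clF]
  split_ifs <;> simp [U_U]

theorem clF_cons' (t : RTree) (ts : List RTree) : clF (t :: ts) = {clT t} + clF ts := rfl

theorem gs_invariant (T : TreeClass) : ∀ F G, clF F = clF G → gs {T} F = gs {T} G := by
  apply invariant_of
  · intro t t' F h1 h2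
    rw [gs_single, gs_single T t', h1, h2]
  · intro t F F' h1 h2
    rw [gs_single, gs_single T t F', h1, h2]
  · intro a b F
    rw [gs_single T a (b :: F), gs_single T b F, gs_single T b (a :: F), gs_single T a F]
    simp only [map_add, U_U, clF_cons', add_comm {clT a} {clT b}]
    abel
  · intro l l' h1 h2
    rw [gs_tree, gs_tree, h1, h2]

theorem elim_clF (T : TreeClass) (F : List RTree) : elim {T} (delta (clF F)) = gs {T} F := by
  rw [elim_delta]
  exact gs_invariant T _ _ (clF_repF _)

/-- The functional giving the coefficient of `T` after grafting on a root. -/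
noncomputable def cc (T : TreeClass) : H →ₗ[ℚ] ℚ := Finsupp.lapply {T} ∘ₗ NN

theorem cc_delta (T : TreeClass) (l : ForestClass) :
    cc T (delta l) = if NC l = T then 1 else 0 := by
  simp [cc, delta, NN, Finsupp.single_apply]

theorem elim_good (T : TreeClass) : Good (elim {T}) fun l => cc T (delta l) := by
  constructor
  · rw [← clF_nil, elim_clF, gs_nil]
  · intro l F
    rw [← clF_repF l, ← clF_repF F]
    generalize repF l = l
    generalize repF F = F
    rw [← clF_cons, elim_clF, elim_clF, elim_clF, gs_tree, cc_delta]

/-! ### Counting single-edge cuts -/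

theorem fullsL_eq (F : List RTree) : ∀ c ∈ cutsF F, fullsL c = (Pcut F c).length := by
  revert F
  apply forest_induction
  · simp [cutsF, fullsL, Pcut]
  · intro l ts hl hts c hc
    simp only [cutsF, List.mem_flatMap, List.mem_cons, List.mem_map] at hc
    obtain ⟨a, rfl | ⟨d, hd, rfl⟩, c', hc', rfl⟩ := hc
    · simp [fullsL, Pcut, hts _ hc', add_comm]
    · simp [fullsL, Pcut, hts _ hc', hl _ hd]

theorem sizeL_append (F G : List RTree) : sizeL (F ++ G) = sizeL F + sizeL G := by
  induction F with
  | nil => simp [sizeL]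
  | cons t F ih => rcases t with ⟨l⟩; simp [sizeL, ih]; omega

theorem sizeL_cut (F : List RTree) : ∀ c ∈ cutsF F,
    sizeL (Pcut F c) + sizeL (Rcut F c) = sizeL F := by
  revert F
  apply forest_induction
  · simp [cutsF, Pcut, Rcut, sizeL]
  · intro l ts hl hts c hc
    simp only [cutsF, List.mem_flatMap, List.mem_cons, List.mem_map] at hc
    obtain ⟨a, rfl | ⟨d, hd, rfl⟩, c', hc', rfl⟩ := hc
    · have := hts _ hc'
      simp only [Pcut, Rcut, sizeL]
      omega
    · have := hts _ hc'
      have := hl _ hd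
      simp only [Pcut, Rcut, sizeL, sizeL_append]
      omega

theorem sizeL_invariant : ∀ F G, clF F = clF G → sizeL F = sizeL G := by
  have hs : ∀ t F, sizeL (t :: F) = sizeL [t] + sizeL F := fun t F => sizeL_append [t] F
  apply invariant_of
  · intro t t' F _ h
    rw [hs, hs t', h]
  · intro t F F' _ h
    rw [hs, hs t F', h]
  · intro a b F
    rw [hs a (b :: F), hs b F, hs b (a :: F), hs a F]; omega
  · intro l l' _ h
    simp [sizeL, h]

theorem clF_rep (T : TreeClass) : clF [repT T] = {T} := by
  have : clF [repT T] = {clT (repT T)} := rfl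
  rw [this]; exact congrArg _ (clT_out T)

theorem aCount_eq (T₁ T₂ T : TreeClass) :
    (aCount T₁ T₂ T : ℚ) = gs {T₁} [repT T] {T₂} := by
  have key : ∀ L : List (List CutShape), (∀ c ∈ L, c ∈ cutsF [repT T]) →
      ((L.countP fun c =>
        decide (fullsL c = 1 ∧ clF (Pcut [repT T] c) = ({T₁} : Multiset TreeClass)
          ∧ clF (Rcut [repT T] c) = ({T₂} : Multiset TreeClass)) : ℕ) : ℚ) =
      (L.map fun c => if clF (Pcut [repT T] c) = {T₁} then
        delta (clF (Rcut [repT T] c)) else 0).sum {T₂} := by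
    intro L
    induction L with
    | nil => intro _; simp
    | cons c L ih =>
      intro hL
      rw [List.countP_cons, List.map_cons, List.sum_cons, Finsupp.add_apply,
        ← ih fun c hc => hL c (List.mem_cons_of_mem _ hc)]
      have hfull := fullsL_eq _ c (hL c List.mem_cons_self)
      by_cases h1 : clF (Pcut [repT T] c) = {T₁}
      · have h2 : fullsL c = 1 := by
          rw [hfull]
          have := congrArg Multiset.card h1
          simpa [clF] using this
        by_cases h3 : clF (Rcut [repT T] c) = {T₂}
        · simp [h1, h2, h3, delta, add_comm]
        · simp [h1, h2, h3, delta]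
      · simp [h1]
  exact key _ fun _ h => h

theorem aCount_NC (T₁ T₂ : TreeClass) (l : ForestClass) :
    (aCount T₁ T₂ (NC l) : ℚ) = cc T₂ (elim {T₁} (delta l)) := by
  rw [← clF_repF l]
  generalize repF l = l
  have h : clF [repT (NC (clF l))] = clF [.node l] := by
    rw [clF_rep, clF_cons]; simp
  rw [aCount_eq, gs_invariant T₁ _ _ h, gs_tree, gs_nil, elim_clF]
  split_ifs <;> simp [cc, U_zero, delta]

theorem forestsUpTo_mem : ∀ (n : ℕ) (F : List RTree), sizeL F ≤ n → F ∈ forestsUpTo n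
  | 0, [], _ => by simp [forestsUpTo]
  | 0, .node l :: ts, h => by simp [sizeL] at h
  | n+1, [], _ => by simp [forestsUpTo]
  | n+1, .node l :: ts, h => by
    simp only [sizeL] at h
    have h1 := forestsUpTo_mem n l (by omega)
    have h2 := forestsUpTo_mem n ts (by omega)
    simp only [forestsUpTo, List.mem_cons, List.mem_flatMap, List.mem_map]
    exact Or.inr ⟨l, h1, ts, h2, rfl⟩

theorem aCount_support (T₁ T₂ T : TreeClass) (h : aCount T₁ T₂ T ≠ 0) :
    T ∈ treeCand (sizeT T₁ + sizeT T₂) := by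
  obtain ⟨c, hc, hp⟩ := List.countP_pos_iff.mp (Nat.pos_of_ne_zero h)
  obtain ⟨-, h1, h2⟩ := of_decide_eq_true hp
  have hsz := sizeL_cut _ c hc
  rw [sizeL_invariant _ _ (h1.trans (clF_rep T₁).symm),
    sizeL_invariant _ _ (h2.trans (clF_rep T₂).symm)] at hsz
  obtain ⟨l, hl, hT⟩ := NC_surj T
  rw [hl] at hsz
  simp only [treeCand, List.mem_toFinset, List.mem_map]
  refine ⟨l, forestsUpTo_mem _ _ ?_, by rw [← NC_clF, hT]⟩
  simp only [sizeT]
  rw [hsz]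
  simp only [sizeL]
  omega

theorem comm_formula (T₁ T₂ : TreeClass) :
      elim ({T₁} : Multiset TreeClass) ∘ₗ elim ({T₂} : Multiset TreeClass)
          - elim ({T₂} : Multiset TreeClass) ∘ₗ elim ({T₁} : Multiset TreeClass)
        = - ∑ T ∈ treeCand (sizeT T₁ + sizeT T₂),
            ((aCount T₁ T₂ T : ℚ) - (aCount T₂ T₁ T : ℚ))
              • elim ({T} : Multiset TreeClass) := by
  rw [eq_neg_iff_add_eq_zero]
  refine Good.eq_zero (((elim_good T₁).comm (elim_good T₂)).add
    (Good.sum _ _ _ _ fun T => elim_good T)) ?_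
  intro l
  simp only [Pi.add_apply, Finset.sum_apply, Pi.smul_apply, cc_delta, smul_eq_mul, mul_ite,
    mul_one, mul_zero, Finset.sum_ite_eq, ← aCount_NC]
  split_ifs with h
  · ring
  · have h1 : aCount T₁ T₂ (NC l) = 0 := by
      by_contra h'
      exact h (aCount_support _ _ _ h')
    have h2 : aCount T₂ T₁ (NC l) = 0 := by
      by_contra h'
      exact h (by rw [add_comm]; exact aCount_support _ _ _ h')
    simp [h1, h2]

/-! ### The bilinear extension -/

/-- The grafting product as a bilinear map. -/
noncomputable def graftL : nT →ₗ[ℚ] nT →ₗ[ℚ] nT :=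
  Finsupp.lsum ℚ fun T₁ => LinearMap.toSpanSingleton ℚ (nT →ₗ[ℚ] nT)
    (Finsupp.lsum ℚ fun T₂ => LinearMap.toSpanSingleton ℚ nT (graftBasis T₁ T₂))

theorem graft_eq (x y : nT) : graft x y = graftL x y := by
  simp only [graft, graftL, Finsupp.lsum_apply, Finsupp.sum, LinearMap.sum_apply,
    LinearMap.toSpanSingleton_apply, LinearMap.smul_apply, Finset.smul_sum, mul_smul]

theorem graftL_tau (T₁ T₂ : TreeClass) : graftL (tau T₁) (tau T₂) = graftBasis T₁ T₂ := by
  simp [graftL, tau]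

theorem rho_tau (T : TreeClass) : rho (tau T) = - elim {T} := by
  simp [rho, tau]

theorem rho_graftBasis (T₁ T₂ : TreeClass) : rho (graftBasis T₁ T₂) =
    - ∑ T ∈ treeCand (sizeT T₁ + sizeT T₂), (aCount T₁ T₂ T : ℚ) • elim {T} := by
  simp [graftBasis, rho_tau]

theorem rho_bracket_tau (T₁ T₂ : TreeClass) :
    rho (graftL (tau T₁) (tau T₂) - graftL (tau T₂) (tau T₁)) =
      rho (tau T₁) ∘ₗ rho (tau T₂) - rho (tau T₂) ∘ₗ rho (tau T₁) := by
  rw [map_sub, graftL_tau, graftL_tau, rho_graftBasis, rho_graftBasis, rho_tau, rho_tau]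
  have h := comm_formula T₁ T₂
  simp only [LinearMap.neg_comp, LinearMap.comp_neg, neg_neg]
  rw [h, add_comm (sizeT T₂)]
  apply LinearMap.ext
  intro z
  simp only [LinearMap.sub_apply, LinearMap.neg_apply, LinearMap.sum_apply, LinearMap.smul_apply,
    sub_smul, Finset.sum_sub_distrib]
  abel

theorem rho_bracket (x y : nT) :
    rho (ckBracket x y) = rho x ∘ₗ rho y - rho y ∘ₗ rho x := by
  rw [ckBracket, graft_eq, graft_eq]
  induction x using Finsupp.induction_linear with
  | zero => simp
  | add x x' hx hx' =>
    rw [map_add, map_add, LinearMap.add_apply, map_add rho, LinearMap.add_comp,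
      LinearMap.comp_add, add_sub_add_comm, add_sub_add_comm, map_add, hx, hx']
  | single T₁ a =>
    induction y using Finsupp.induction_linear with
    | zero => simp
    | add x x' hx hx' =>
      rw [map_add, map_add, LinearMap.add_apply, map_add rho, LinearMap.add_comp,
        LinearMap.comp_add, add_sub_add_comm, add_sub_add_comm, map_add, hx, hx']
    | single T₂ b =>
      have h1 : (Finsupp.single T₁ a : nT) = a • tau T₁ := by simp [tau]
      have h2 : (Finsupp.single T₂ b : nT) = b • tau T₂ := by simp [tau]
      have h := rho_bracket_tau T₁ T₂
      rw [h1, h2]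
      simp only [map_smul, LinearMap.smul_apply, LinearMap.smul_comp, LinearMap.comp_smul]
      rw [smul_comm a b (rho (tau T₂) ∘ₗ rho (tau T₁)), smul_comm a b (graftL (tau T₂) (tau T₁)),
        ← smul_sub, ← smul_sub, map_smul, map_smul, h]
      apply LinearMap.ext
      intro z
      simp only [LinearMap.sub_apply, LinearMap.smul_apply, smul_sub]

/-- STATEMENT 10: the elimination operators represent `n_T`: for all rooted
trees `T₁, T₂`,
`E_{T₁}∘E_{T₂} − E_{T₂}∘E_{T₁} = −Σ_T (a(T₁,T₂;T) − a(T₂,T₁;T))·E_T`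
(sum over isomorphism classes of rooted trees `T`; it is supported on trees
with `|T₁| + |T₂|` vertices, hence captured by the candidate set).
Equivalently, `T ↦ −E_T` is a homomorphism of Lie algebras, so the
elimination action `X_T·φ := −E_T φ` makes `H*` a representation of `n_T`. -/
theorem elimination_representation :
    (∀ T₁ T₂ : TreeClass,
      elim ({T₁} : Multiset TreeClass) ∘ₗ elim ({T₂} : Multiset TreeClass)
          - elim ({T₂} : Multiset TreeClass) ∘ₗ elim ({T₁} : Multiset TreeClass)
        = - ∑ T ∈ treeCand (sizeT T₁ + sizeT T₂),
            ((aCount T₁ T₂ T : ℚ) - (aCount T₂ T₁ T : ℚ))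
              • elim ({T} : Multiset TreeClass)) ∧
    (∀ x y : nT, rho (ckBracket x y) = rho x ∘ₗ rho y - rho y ∘ₗ rho x) :=
  ⟨comm_formula, rho_bracket⟩

end CK
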